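/- Let D ∈ ℝ^{n×n} be positive semidefinite, d ∈ ℝ^n, and let λ_P be the largest real eigenvalue of the 2n×2n matrix P = [[D, I],[dd', D]]. Then λ_P ≥ ‖D‖ always holds, and λ_P = ‖D‖ if and only if both (i) d ∈ R(D − ‖D‖I) and (ii) ‖(D − ‖D‖I)⁺d‖ ≤ 1. If (i) or (ii) fails, then λ_P > ‖D‖ and ‖(D − λ_P I)^{−1}d‖ = 1. -/

import Mathlib

open Matrix Set

noncomputable section

/-- `Ap` is the Moore–Penrose pseudoinverse of `A`. -/
def IsMoorePenrose {m n : Type*} [Fintype m] [Fintype n] (A : Matrix m n ℝ)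
    (Ap : Matrix n m ℝ) : Prop :=
  A * Ap * A = A ∧ Ap * A * Ap = Ap ∧ (A * Ap)ᵀ = A * Ap ∧ (Ap * A)ᵀ = Ap * A

/-- The spectral norm of a real square matrix: `sup {|v'Av| : ‖v‖ = 1}` (for a symmetric
positive semidefinite matrix this is the largest eigenvalue). -/
def specNorm {n : Type*} [Fintype n] (A : Matrix n n ℝ) : ℝ :=
  sSup {r | ∃ v : n → ℝ, v ⬝ᵥ v = 1 ∧ r = |v ⬝ᵥ A.mulVec v|}

/-- The Euclidean norm of a real vector. -/
def eucNorm {n : Type*} [Fintype n] (v : n → ℝ) : ℝ := Real.sqrt (v ⬝ᵥ v)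

theorem aux_compact {n : ℕ} : IsCompact {v : Fin n → ℝ | v ⬝ᵥ v ≤ 1} := by
  apply Metric.isCompact_of_isClosed_isBounded
  · exact isClosed_le (by fun_prop) continuous_const
  · refine (Metric.isBounded_closedBall (x := (0 : Fin n → ℝ)) (r := 1)).subset ?_
    intro v hv
    rw [mem_closedBall_zero_iff, pi_norm_le_iff_of_nonneg zero_le_one]
    intro i
    have h1 : v i * v i ≤ v ⬝ᵥ v :=
      Finset.single_le_sum (f := fun i => v i * v i) (fun i _ => mul_self_nonneg _)
        (Finset.mem_univ i)
    have h2 : v ⬝ᵥ v ≤ 1 := hv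
    rw [Real.norm_eq_abs]
    exact abs_le_one_iff_mul_self_le_one.2 (h1.trans h2)

theorem aux_nonneg {n : ℕ} (v : Fin n → ℝ) : 0 ≤ v ⬝ᵥ v :=
  Finset.sum_nonneg (fun i _ => mul_self_nonneg _)

theorem aux_specNorm_exists {n : ℕ} (hn : 0 < n) (D : Matrix (Fin n) (Fin n) ℝ)
    (hD : D.PosSemidef) :
    (∀ v : Fin n → ℝ, v ⬝ᵥ D.mulVec v ≤ specNorm D * (v ⬝ᵥ v)) ∧
    ∃ u : Fin n → ℝ, u ⬝ᵥ u = 1 ∧ u ⬝ᵥ D.mulVec u = specNorm D := by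
  have hpos : ∀ v : Fin n → ℝ, 0 ≤ v ⬝ᵥ D.mulVec v := fun v => by
    simpa using hD.dotProduct_mulVec_nonneg v
  have himg : {r | ∃ v : Fin n → ℝ, v ⬝ᵥ v = 1 ∧ r = |v ⬝ᵥ D.mulVec v|}
      = (fun v : Fin n → ℝ => |v ⬝ᵥ D.mulVec v|) '' {v | v ⬝ᵥ v = 1} := by
    ext r
    constructor
    · rintro ⟨v, h, rfl⟩; exact ⟨v, h, rfl⟩
    · rintro ⟨v, h, rfl⟩; exact ⟨v, h, rfl⟩
  have hc : IsCompact {v : Fin n → ℝ | v ⬝ᵥ v = 1} :=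
    aux_compact.of_isClosed_subset (isClosed_eq (by fun_prop) continuous_const)
      (fun v hv => le_of_eq hv)
  have hci := hc.image (f := fun v : Fin n → ℝ => |v ⬝ᵥ D.mulVec v|) (by fun_prop)
  have hne : ((fun v : Fin n → ℝ => |v ⬝ᵥ D.mulVec v|) '' {v | v ⬝ᵥ v = 1}).Nonempty := by
    refine ⟨_, Pi.single ⟨0, hn⟩ 1, ?_, rfl⟩
    simp
  constructor
  · intro v
    by_cases hv : v ⬝ᵥ v = 0
    · have : v = 0 := dotProduct_self_eq_zero.1 hv
      simp [this]
    · have hv0 : 0 < v ⬝ᵥ v := lt_of_le_of_ne (aux_nonneg v) (Ne.symm hv)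
      have hs : 0 < Real.sqrt (v ⬝ᵥ v) := Real.sqrt_pos.2 hv0
      have hss : Real.sqrt (v ⬝ᵥ v) * Real.sqrt (v ⬝ᵥ v) = v ⬝ᵥ v := Real.mul_self_sqrt hv0.le
      set s := Real.sqrt (v ⬝ᵥ v)
      have hle : |(s⁻¹ • v) ⬝ᵥ D.mulVec (s⁻¹ • v)| ≤ specNorm D := by
        unfold specNorm
        rw [himg]
        refine le_csSup hci.bddAbove ⟨s⁻¹ • v, ?_, rfl⟩
        simp only [Set.mem_ofPred_eq, smul_dotProduct, dotProduct_smul, smul_eq_mul, ← hss]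
        field_simp
      have h2 := (le_abs_self _).trans hle
      simp only [mulVec_smul, smul_dotProduct, dotProduct_smul, smul_eq_mul] at h2
      rw [← hss]
      have : v ⬝ᵥ D.mulVec v = (s⁻¹ * (s⁻¹ * (v ⬝ᵥ D.mulVec v))) * (s * s) := by
        field_simp
      rw [this]
      exact mul_le_mul_of_nonneg_right h2 (mul_self_nonneg _)
  · obtain ⟨u, hu, h⟩ := hci.sSup_mem hne
    refine ⟨u, hu, ?_⟩
    unfold specNorm
    rw [himg, ← h]
    exact (abs_of_nonneg (hpos u)).symm

theorem aux_symm {n : ℕ} {B : Matrix (Fin n) (Fin n) ℝ} (hB : Bᵀ = B) (x y : Fin n → ℝ) :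
    x ⬝ᵥ B.mulVec y = B.mulVec x ⬝ᵥ y := by
  rw [dotProduct_mulVec, ← mulVec_transpose, hB]

theorem aux_sub {n : ℕ} (D : Matrix (Fin n) (Fin n) ℝ) (μ : ℝ) (x : Fin n → ℝ) :
    (D - μ • 1).mulVec x = D.mulVec x - μ • x := by
  rw [sub_mulVec, smul_mulVec, one_mulVec]

theorem aux_eig {n : ℕ} (D : Matrix (Fin n) (Fin n) ℝ) (d : Fin n → ℝ) (μ : ℝ)
    (hB : (D - μ • 1)ᵀ = D - μ • 1)
    (hu : IsUnit (D - μ • (1 : Matrix (Fin n) (Fin n) ℝ)).det) :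
    (∃ v : Fin n ⊕ Fin n → ℝ, v ≠ 0 ∧
        (Matrix.fromBlocks D 1 (Matrix.vecMulVec d d) D).mulVec v = μ • v) ↔
      ((D - μ • 1)⁻¹.mulVec d) ⬝ᵥ ((D - μ • 1)⁻¹.mulVec d) = 1 := by
  have hd : (D - μ • 1).mulVec ((D - μ • 1)⁻¹.mulVec d) = d := by
    rw [mulVec_mulVec, mul_nonsing_inv _ hu, one_mulVec]
  have hinj : ∀ x, (D - μ • 1)⁻¹.mulVec ((D - μ • 1).mulVec x) = x := fun x => by
    rw [mulVec_mulVec, nonsing_inv_mul _ hu, one_mulVec]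
  have hsur : ∀ x, (D - μ • 1).mulVec ((D - μ • 1)⁻¹.mulVec x) = x := fun x => by
    rw [mulVec_mulVec, mul_nonsing_inv _ hu, one_mulVec]
  set z := (D - μ • 1)⁻¹.mulVec d with hz
  constructor
  · rintro ⟨v, hv0, hv⟩
    obtain ⟨x, y, rfl⟩ : ∃ x y : Fin n → ℝ, v = Sum.elim x y :=
      ⟨v ∘ Sum.inl, v ∘ Sum.inr, (Sum.elim_comp_inl_inr v).symm⟩
    rw [fromBlocks_mulVec] at hv
    have h1 : D.mulVec x + y = μ • x := by
      ext i
      have := congrFun hv (Sum.inl i)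
      simpa using this
    have h2 : (d ⬝ᵥ x) • d + D.mulVec y = μ • y := by
      ext i
      have := congrFun hv (Sum.inr i)
      simpa [vecMulVec_mulVec, mul_comm] using this
    have hy : (D - μ • 1).mulVec x = -y := by
      rw [aux_sub, ← h1]; abel
    have hy2 : (D - μ • 1).mulVec y = -((d ⬝ᵥ x) • d) := by
      rw [aux_sub, ← h2]; abel
    have hyz : y = -((d ⬝ᵥ x) • z) := by
      rw [← hinj y, hy2, mulVec_neg, mulVec_smul]
    have h3 : d ⬝ᵥ x = (d ⬝ᵥ x) * (z ⬝ᵥ z) := by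
      have : d ⬝ᵥ x = z ⬝ᵥ (D - μ • 1).mulVec x := by rw [aux_symm hB, hd]
      rw [hy, hyz] at this
      simpa using this
    by_cases h0 : d ⬝ᵥ x = 0
    · exfalso
      apply hv0
      have hy0 : y = 0 := by rw [hyz, h0]; simp
      have hx0 : x = 0 := by rw [← hinj x, hy, hy0]; simp
      rw [hy0, hx0]
      ext i; rcases i with i | i <;> rfl
    · exact (mul_left_cancel₀ h0 (by rw [mul_one]; exact h3)).symm
  · intro h
    have hB1 := hsur z
    set x := (D - μ • 1)⁻¹.mulVec z with hx
    have hdx : d ⬝ᵥ x = 1 := by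
      rw [← hd, ← aux_symm hB, hB1, h]
    have e1 : D.mulVec x - μ • x = z := by rw [← aux_sub]; exact hB1
    have e2 : D.mulVec z - μ • z = d := by rw [← aux_sub]; exact hd
    refine ⟨Sum.elim x (-z), ?_, ?_⟩
    · intro h0
      have : z = 0 := by
        ext i
        have := congrFun h0 (Sum.inr i)
        simpa using this
      rw [this] at h
      simp at h
    · rw [fromBlocks_mulVec]
      ext i
      rcases i with i | i
      · have := congrFun e1 i
        simp at this ⊢
        linarith
      · have := congrFun e2 i
        simp [vecMulVec_mulVec, hdx, mulVec_neg] at this ⊢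
        linarith

theorem aux_unit {n : ℕ} (D : Matrix (Fin n) (Fin n) ℝ) (M μ : ℝ)
    (hM : ∀ v : Fin n → ℝ, v ⬝ᵥ D.mulVec v ≤ M * (v ⬝ᵥ v)) (h : M < μ) :
    IsUnit (D - μ • (1 : Matrix (Fin n) (Fin n) ℝ)).det := by
  rw [isUnit_iff_ne_zero]
  intro h0
  obtain ⟨v, hv, hv0⟩ := exists_mulVec_eq_zero_iff.2 h0
  rw [aux_sub] at hv0
  have h1 := hM v
  rw [sub_eq_zero.1 hv0, dotProduct_smul, smul_eq_mul] at h1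
  have h2 : 0 < v ⬝ᵥ v :=
    lt_of_le_of_ne (aux_nonneg v) (fun h => hv (dotProduct_self_eq_zero.1 h.symm))
  nlinarith

theorem aux_cont {n : ℕ} (D : Matrix (Fin n) (Fin n) ℝ) (d : Fin n → ℝ) (M : ℝ)
    (hu : ∀ μ, M < μ → IsUnit (D - μ • (1 : Matrix (Fin n) (Fin n) ℝ)).det) :
    ContinuousOn (fun μ : ℝ => ((D - μ • 1)⁻¹.mulVec d) ⬝ᵥ ((D - μ • 1)⁻¹.mulVec d))
      (Set.Ioi M) := by
  have h1 : ContinuousOn (fun μ : ℝ => (D - μ • (1 : Matrix (Fin n) (Fin n) ℝ))⁻¹)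
      (Set.Ioi M) := by
    simp only [inv_def, Ring.inverse_eq_inv']
    refine ContinuousOn.smul (f := fun μ : ℝ => (D - μ • (1 : Matrix (Fin n) (Fin n) ℝ)).det⁻¹)
      (g := fun μ : ℝ => (D - μ • (1 : Matrix (Fin n) (Fin n) ℝ)).adjugate) ?_ ?_
    · apply ContinuousOn.inv₀
      · exact Continuous.continuousOn (Continuous.matrix_det (by fun_prop))
      · intro μ hμ; exact (hu μ hμ).ne_zero
    · exact Continuous.continuousOn (Continuous.matrix_adjugate (by fun_prop))
  have h2 : Continuous (fun A : Matrix (Fin n) (Fin n) ℝ => (A.mulVec d) ⬝ᵥ (A.mulVec d)) := by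
    fun_prop
  exact h2.comp_continuousOn h1

/-- The solution at large `μ` is small. -/
theorem aux_large {n : ℕ} (D : Matrix (Fin n) (Fin n) ℝ) (d z : Fin n → ℝ) (M μ : ℝ)
    (hM : ∀ v : Fin n → ℝ, v ⬝ᵥ D.mulVec v ≤ M * (v ⬝ᵥ v))
    (h : M + d ⬝ᵥ d + 1 ≤ μ) (hz : (D - μ • 1).mulVec z = d) : z ⬝ᵥ z ≤ 1 := by
  have h1 := hM z
  have h2 : z ⬝ᵥ D.mulVec z - μ * (z ⬝ᵥ z) = z ⬝ᵥ d := by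
    rw [← hz, aux_sub, dotProduct_sub, dotProduct_smul, smul_eq_mul]
  have h3 := aux_nonneg (z + d)
  have e : (z + d) ⬝ᵥ (z + d) = z ⬝ᵥ z + 2 * (z ⬝ᵥ d) + d ⬝ᵥ d := by
    rw [add_dotProduct, dotProduct_add, dotProduct_add, dotProduct_comm d z]; ring
  have hd := aux_nonneg d
  have hzz := aux_nonneg z
  rw [e] at h3
  by_contra hc
  push Not at hc
  nlinarith [mul_le_mul_of_nonneg_right h hzz, mul_nonneg hd (sub_nonneg.2 hc.le)]

/-- The pseudoinverse gives the least norm solution. -/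
theorem aux_pinv {n : ℕ} (A Ap : Matrix (Fin n) (Fin n) ℝ) (h : IsMoorePenrose A Ap)
    (w : Fin n → ℝ) :
    (Ap.mulVec (A.mulVec w)) ⬝ᵥ (Ap.mulVec (A.mulVec w)) ≤ w ⬝ᵥ w := by
  obtain ⟨-, h2, -, h4⟩ := h
  rw [mulVec_mulVec]
  have hQ : (Ap * A) * (Ap * A) = Ap * A := by rw [← mul_assoc, h2]
  set Q := Ap * A
  have e1 : Q.mulVec w ⬝ᵥ Q.mulVec w = w ⬝ᵥ Q.mulVec w := by
    rw [← aux_symm h4, mulVec_mulVec, hQ]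
  have h3 := aux_nonneg (w - Q.mulVec w)
  have e : (w - Q.mulVec w) ⬝ᵥ (w - Q.mulVec w)
      = w ⬝ᵥ w - 2 * (w ⬝ᵥ Q.mulVec w) + Q.mulVec w ⬝ᵥ Q.mulVec w := by
    rw [sub_dotProduct, dotProduct_sub, dotProduct_sub, dotProduct_comm (Q.mulVec w) w]; ring
  rw [e] at h3
  linarith

/-- If all regularized solutions have norm at most one, so does some limiting solution. -/
theorem aux_limit {n : ℕ} (D : Matrix (Fin n) (Fin n) ℝ) (d : Fin n → ℝ) (M : ℝ)
    (z : ℝ → Fin n → ℝ) (hz : ∀ μ, M < μ → (D - μ • 1).mulVec (z μ) = d)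
    (h1 : ∀ μ, M < μ → z μ ⬝ᵥ z μ ≤ 1) :
    ∃ w : Fin n → ℝ, (D - M • 1).mulVec w = d ∧ w ⬝ᵥ w ≤ 1 := by
  have hlt : ∀ k : ℕ, M < M + 1 / ((k : ℝ) + 1) := fun k => by
    have : 0 < 1 / ((k : ℝ) + 1) := by positivity
    linarith
  obtain ⟨w, hw, φ, hφ, hlim⟩ := aux_compact.tendsto_subseq
    (x := fun k : ℕ => z (M + 1 / ((k : ℝ) + 1))) (fun k => h1 _ (hlt k))
  refine ⟨w, ?_, hw⟩
  have hμ : Filter.Tendsto (fun k : ℕ => M + 1 / ((φ k : ℝ) + 1)) Filter.atTop (nhds M) := by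
    have := (tendsto_one_div_add_atTop_nhds_zero_nat (𝕜 := ℝ)).comp hφ.tendsto_atTop
    simpa using this.const_add M
  have hc : Continuous (fun p : ℝ × (Fin n → ℝ) => (D - p.1 • 1).mulVec p.2) := by fun_prop
  have ht := (hc.tendsto (M, w)).comp (hμ.prodMk_nhds hlim)
  refine tendsto_nhds_unique ht ?_
  refine tendsto_const_nhds.congr (fun k => ?_)
  exact (hz _ (hlt (φ k))).symm

/-- A norm-one regularized solution excludes a solution of norm at most one. -/
theorem aux_strict {n : ℕ} (D : Matrix (Fin n) (Fin n) ℝ) (d z w : Fin n → ℝ) (M μ : ℝ)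
    (hM : ∀ v : Fin n → ℝ, v ⬝ᵥ D.mulVec v ≤ M * (v ⬝ᵥ v)) (h : M < μ)
    (hz : (D - μ • 1).mulVec z = d) (hz1 : z ⬝ᵥ z = 1)
    (hw : (D - M • 1).mulVec w = d) (hw1 : w ⬝ᵥ w ≤ 1) : False := by
  have h1 := hM (w - z)
  have e0 : D.mulVec (w - z) - M • (w - z) = (M - μ) • z := by
    rw [aux_sub] at hz hw
    have : D.mulVec w = M • w + (D.mulVec z - μ • z) := by rw [hz, ← hw]; abel
    rw [mulVec_sub, this]
    module
  have e1 : (w - z) ⬝ᵥ D.mulVec (w - z) - M * ((w - z) ⬝ᵥ (w - z))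
      = (M - μ) * (w ⬝ᵥ z - z ⬝ᵥ z) := by
    rw [← smul_eq_mul M, ← dotProduct_smul, ← dotProduct_sub, e0, dotProduct_smul,
      sub_dotProduct, smul_eq_mul]
  have e : (w - z) ⬝ᵥ (w - z) = w ⬝ᵥ w - 2 * (w ⬝ᵥ z) + z ⬝ᵥ z := by
    rw [sub_dotProduct, dotProduct_sub, dotProduct_sub, dotProduct_comm z w]; ring
  have h2 : 0 ≤ w ⬝ᵥ z - z ⬝ᵥ z := by
    by_contra hc
    push Not at hc
    nlinarith [mul_pos_of_neg_of_neg (sub_neg.2 h) hc]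
  have h3 : w - z = 0 := dotProduct_self_eq_zero.1
    (le_antisymm (by rw [e]; linarith) (aux_nonneg _))
  rw [h3] at e0
  have h4 : (M - μ) • z = 0 := by rw [← e0]; simp
  rcases smul_eq_zero.1 h4 with h5 | h5
  · linarith
  · rw [h5] at hz1; simp at hz1

theorem aux_sqrt {x : ℝ} : Real.sqrt x ≤ 1 ↔ x ≤ 1 := by
  rw [Real.sqrt_le_left zero_le_one, one_pow]

/-- For `D ⪰ 0` and `λ_P` the largest real eigenvalue of `P = [[D,I],[dd',D]]`:
`λ_P ≥ ‖D‖` always holds; `λ_P = ‖D‖` iff (i) `d ∈ R(D−‖D‖I)` and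
(ii) `‖(D−‖D‖I)⁺d‖ ≤ 1`; and if (i) or (ii) fails then `λ_P > ‖D‖` and
`‖(D−λ_P I)⁻¹d‖ = 1`. -/
theorem stmt15 {n : ℕ} (D : Matrix (Fin n) (Fin n) ℝ) (hD : D.PosSemidef)
    (d : Fin n → ℝ) (lamP : ℝ)
    (hlamP : IsGreatest
      {μ : ℝ | ∃ v : Fin n ⊕ Fin n → ℝ, v ≠ 0 ∧
        (Matrix.fromBlocks D 1 (Matrix.vecMulVec d d) D).mulVec v = μ • v} lamP)
    (DNp : Matrix (Fin n) (Fin n) ℝ)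
    (hDNp : IsMoorePenrose (D - specNorm D • 1) DNp) :
    specNorm D ≤ lamP ∧
    (lamP = specNorm D ↔
      d ∈ Set.range (D - specNorm D • 1).mulVec ∧ eucNorm (DNp.mulVec d) ≤ 1) ∧
    (¬ (d ∈ Set.range (D - specNorm D • 1).mulVec ∧ eucNorm (DNp.mulVec d) ≤ 1) →
      specNorm D < lamP ∧ eucNorm ((D - lamP • 1)⁻¹.mulVec d) = 1) := by
  have hn : 0 < n := by
    rcases Nat.eq_zero_or_pos n with rfl | h
    · obtain ⟨v, hv, -⟩ := hlamP.1
      exact absurd (Subsingleton.elim v 0) hv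
    · exact h
  obtain ⟨hM, u, hu1, huM⟩ := aux_specNorm_exists hn D hD
  have hDt : Dᵀ = D := by
    have := hD.isHermitian.eq
    rwa [conjTranspose_eq_transpose_of_trivial] at this
  have hsym : ∀ μ : ℝ, (D - μ • (1 : Matrix (Fin n) (Fin n) ℝ))ᵀ = D - μ • 1 := fun μ => by
    rw [transpose_sub, transpose_smul, transpose_one, hDt]
  set M := specNorm D with hMdef
  have hunit : ∀ μ, M < μ → IsUnit (D - μ • (1 : Matrix (Fin n) (Fin n) ℝ)).det :=
    fun μ h => aux_unit D M μ hM h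
  have hsol : ∀ μ, M < μ → (D - μ • 1).mulVec ((D - μ • 1)⁻¹.mulVec d) = d := fun μ h => by
    rw [mulVec_mulVec, mul_nonsing_inv _ (hunit μ h), one_mulVec]
  -- the top eigenvector
  have hDu : (D - M • 1).mulVec u = 0 := by
    have hN : (M • (1 : Matrix (Fin n) (Fin n) ℝ) - D).PosSemidef := by
      refine PosSemidef.of_dotProduct_mulVec_nonneg ?_ ?_
      · unfold IsHermitian
        rw [conjTranspose_eq_transpose_of_trivial, transpose_sub, transpose_smul, transpose_one,
          hDt]
      · intro x
        have := hM x
        simp only [star_trivial, sub_mulVec, smul_mulVec, one_mulVec, dotProduct_sub,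
          dotProduct_smul, smul_eq_mul]
        linarith
    have h0 := (hN.dotProduct_mulVec_zero_iff u).1 (by
      simp only [star_trivial, sub_mulVec, smul_mulVec, one_mulVec, dotProduct_sub,
          dotProduct_smul, smul_eq_mul, hu1, huM]
      ring)
    rw [← neg_sub, neg_mulVec, h0, neg_zero]
  -- if the conditions hold
  have hgood : (d ∈ Set.range (D - M • 1).mulVec ∧ eucNorm (DNp.mulVec d) ≤ 1) →
      lamP = M := by
    rintro ⟨⟨w, hw⟩, hle⟩
    have hge : M ≤ lamP := by
      apply hlamP.2
      have hdu : d ⬝ᵥ u = 0 := by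
        rw [← hw, ← aux_symm (hsym M), hDu, dotProduct_zero]
      refine ⟨Sum.elim u 0, ?_, ?_⟩
      · intro h0
        have : u = 0 := by
          ext i
          have := congrFun h0 (Sum.inl i)
          simpa using this
        rw [this] at hu1
        simp at hu1
      · rw [aux_sub] at hDu
        rw [fromBlocks_mulVec]
        ext i
        rcases i with i | i
        · have := congrFun hDu i
          simp at this ⊢
          linarith
        · simp [vecMulVec_mulVec, hdu]
    refine le_antisymm ?_ hge
    by_contra hc
    push Not at hc
    have hone := (aux_eig D d lamP (hsym _) (hunit _ hc)).1 hlamP.1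
    have hle2 : DNp.mulVec d ⬝ᵥ DNp.mulVec d ≤ 1 := by
      unfold eucNorm at hle
      exact aux_sqrt.1 hle
    refine aux_strict D d _ (DNp.mulVec d) M lamP hM hc (hsol _ hc) hone ?_ hle2
    rw [← hw, mulVec_mulVec, mulVec_mulVec, hDNp.1]
  -- if the conditions fail
  have hbad : ¬ (d ∈ Set.range (D - M • 1).mulVec ∧ eucNorm (DNp.mulVec d) ≤ 1) →
      M < lamP ∧ eucNorm ((D - lamP • 1)⁻¹.mulVec d) = 1 := by
    intro hnot
    have hex : ∃ μ, M < μ ∧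
        1 < ((D - μ • 1)⁻¹.mulVec d) ⬝ᵥ ((D - μ • 1)⁻¹.mulVec d) := by
      by_contra hc
      push Not at hc
      obtain ⟨w, hw, hw1⟩ := aux_limit D d M (fun μ => (D - μ • 1)⁻¹.mulVec d) hsol hc
      refine hnot ⟨⟨w, hw⟩, ?_⟩
      unfold eucNorm
      refine aux_sqrt.2 ?_
      have := aux_pinv _ _ hDNp w
      rw [hw] at this
      exact this.trans hw1
    obtain ⟨μ₀, hμ₀, hgt⟩ := hex
    have hdd := aux_nonneg d
    have hle : μ₀ ≤ μ₀ + d ⬝ᵥ d + 1 := by linarith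
    have hsmall := aux_large D d _ M (μ₀ + d ⬝ᵥ d + 1) hM (by linarith)
      (hsol _ (by linarith))
    have hcont := (aux_cont D d M hunit).mono
      (fun μ (hμ : μ ∈ Set.Icc μ₀ (μ₀ + d ⬝ᵥ d + 1)) => lt_of_lt_of_le hμ₀ hμ.1)
    obtain ⟨μ, hμ, hμ1⟩ := intermediate_value_Icc' hle hcont ⟨hsmall, hgt.le⟩
    have hMμ : M < μ := lt_of_lt_of_le hμ₀ hμ.1
    have hlt : M < lamP :=
      lt_of_lt_of_le hMμ (hlamP.2 ((aux_eig D d μ (hsym _) (hunit _ hMμ)).2 hμ1))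
    refine ⟨hlt, ?_⟩
    unfold eucNorm
    rw [(aux_eig D d lamP (hsym _) (hunit _ hlt)).1 hlamP.1, Real.sqrt_one]
  refine ⟨?_, ⟨?_, hgood⟩, hbad⟩
  · by_cases h : d ∈ Set.range (D - M • 1).mulVec ∧ eucNorm (DNp.mulVec d) ≤ 1
    · exact (hgood h).ge
    · exact (hbad h).1.le
  · intro h
    by_contra hc
    exact (hbad hc).1.ne' h
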